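/- Pressure-work identity under the algebraic closure. Let d ≥ 1 and γ₊, γ₋ > 1. Let α₊, α₋, ρ₊, ρ₋ : ℝ × ℝ^d → ℝ and u : ℝ × ℝ^d → ℝ^d be smooth ℤ^d-periodic functions with ρ₊ > 0, ρ₋ > 0, satisfying: α₊ + α₋ = 1; the mass equations ∂ₜ(α±ρ±) + div(α±ρ±u) = 0 for both phases; and ρ₊^{γ₊} = ρ₋^{γ₋}. Then for every time t: ∫_{[0,1]^d} ( α₊∇(ρ₊^{γ₊}) + α₋∇(ρ₋^{γ₋}) )·u dx = d/dt ∫_{[0,1]^d} [ α₊ρ₊^{γ₊}/(γ₊−1) + α₋ρ₋^{γ₋}/(γ₋−1) ] dx. -/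

import Mathlib

open MeasureTheory Real

noncomputable section

/-- A space–time point: time in `ℝ`, space in `ℝ^d`. -/
abbrev Pt (d : ℕ) := ℝ × (Fin d → ℝ)

/-- Time derivative `∂ₜ f`. -/
def pt {d : ℕ} (f : Pt d → ℝ) (p : Pt d) : ℝ :=
  fderiv ℝ f p (1, 0)

/-- Spatial partial derivative `∂_{x i} f`. -/
def pd {d : ℕ} (i : Fin d) (f : Pt d → ℝ) (p : Pt d) : ℝ :=
  fderiv ℝ f p (0, Pi.single i 1)

/-- Spatial divergence of a vector field. -/
def divg {d : ℕ} (u : Pt d → Fin d → ℝ) (p : Pt d) : ℝ :=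
  ∑ i, pd i (fun q => u q i) p

/-- Spatial Laplacian of a scalar function. -/
def lap {d : ℕ} (f : Pt d → ℝ) (p : Pt d) : ℝ :=
  ∑ i, pd i (fun q => pd i f q) p

/-- `i`-th component of `div (r u ⊗ u)`, i.e. `∑ j ∂_{x j} (r u_i u_j)`. -/
def divT {d : ℕ} (r : Pt d → ℝ) (u : Pt d → Fin d → ℝ) (p : Pt d) (i : Fin d) : ℝ :=
  ∑ j, pd j (fun q => r q * u q i * u q j) p

/-- Symmetric gradient `D(u) = (∇u + (∇u)ᵀ)/2`. -/
def Dsym {d : ℕ} (u : Pt d → Fin d → ℝ) (p : Pt d) (i j : Fin d) : ℝ :=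
  (pd j (fun q => u q i) p + pd i (fun q => u q j) p) / 2

/-- Divergence of a matrix field, `i`-th component `∑ j ∂_{x j} M_{ij}`. -/
def divM {d : ℕ} (M : Pt d → Fin d → Fin d → ℝ) (p : Pt d) (i : Fin d) : ℝ :=
  ∑ j, pd j (fun q => M q i j) p

/-- `ℤ^d`-periodicity in the space variable. -/
def ZPeriodic {d : ℕ} (f : Pt d → ℝ) : Prop :=
  ∀ (k : Fin d → ℤ) (t : ℝ) (x : Fin d → ℝ), f (t, x + fun i => (k i : ℝ)) = f (t, x)

/-- `ℤ^d`-periodicity of a vector field. -/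
def ZPeriodicVec {d : ℕ} (u : Pt d → Fin d → ℝ) : Prop :=
  ∀ i, ZPeriodic (fun q => u q i)

/-- The unit cell `[0,1]^d`. -/
def cell (d : ℕ) : Set (Fin d → ℝ) := Set.Icc 0 1

theorem hasFDerivAt_slice {d : ℕ} {f : Pt d → ℝ} (hf : ContDiff ℝ 1 f) (t : ℝ)
    (x : Fin d → ℝ) :
    HasFDerivAt (fun y => f (t, y))
      ((fderiv ℝ f (t, x)).comp (ContinuousLinearMap.inr ℝ ℝ (Fin d → ℝ))) x :=
  (hf.differentiable (by norm_num) (t, x)).hasFDerivAt.comp x (hasFDerivAt_prodMk_right t x)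

theorem continuous_pd {d : ℕ} {f : Pt d → ℝ} (hf : ContDiff ℝ 1 f) (i : Fin d) :
    Continuous (pd i f) :=
  (hf.continuous_fderiv (by norm_num)).clm_apply continuous_const

theorem continuous_pt {d : ℕ} {f : Pt d → ℝ} (hf : ContDiff ℝ 1 f) : Continuous (pt f) :=
  (hf.continuous_fderiv (by norm_num)).clm_apply continuous_const

/-- The divergence of a periodic `C¹` field has zero integral over the unit cell. -/
theorem integral_cell_divg_eq_zero {d : ℕ} {F : Pt d → Fin d → ℝ}
    (hF : ∀ i, ContDiff ℝ 1 (fun q => F q i)) (hper : ZPeriodicVec F) (t : ℝ) :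
    ∫ x in cell d, divg F (t, x) = 0 := by
  cases d with
  | zero => simp [divg]
  | succ n =>
    have hcont : Continuous fun x : Fin (n + 1) → ℝ => divg F (t, x) :=
      continuous_finsetSum _ fun i _ => (continuous_pd (hF i) i).comp (by fun_prop)
    have key := integral_divergence_of_hasFDerivAt_off_countable' (0 : Fin (n + 1) → ℝ) 1
      zero_le_one (fun i x => F (t, x) i)
      (fun i x => (fderiv ℝ (fun q => F q i) (t, x)).comp
        (ContinuousLinearMap.inr ℝ ℝ (Fin (n + 1) → ℝ))) ∅ Set.countable_empty
      (fun i => ((hF i).continuous.comp (by fun_prop : Continuous fun x => (t, x))).continuousOn)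
      (fun x _ i => hasFDerivAt_slice (hF i) t x)
      (hcont.integrableOn_Icc)
    refine key.trans (Finset.sum_eq_zero fun i _ => sub_eq_zero.2 ?_)
    refine integral_congr_ae (Filter.Eventually.of_forall fun y => ?_)
    have h := hper i (Pi.single i 1) t (i.insertNth 0 y)
    have h2 : (i.insertNth (0 : ℝ) y + fun j => (((Pi.single i 1 : Fin (n + 1) → ℤ) j : ℤ) : ℝ))
        = (i.insertNth (1 : ℝ) y : Fin (n + 1) → ℝ) := by
      funext j
      refine Fin.succAboveCases i ?_ (fun k => ?_) j
      · simp
      · simp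
    rw [h2] at h
    exact h

/-- Differentiation under the integral over the unit cell. -/
theorem hasDerivAt_integral_cell {d : ℕ} {G : Pt d → ℝ} (hG : ContDiff ℝ 1 G) (t : ℝ) :
    HasDerivAt (fun s => ∫ x in cell d, G (s, x)) (∫ x in cell d, pt G (t, x)) t := by
  have hc := continuous_pt hG
  have hcell : IsCompact (cell d) := isCompact_Icc
  obtain ⟨C, hC⟩ := ((isCompact_closedBall t 1).prod hcell).exists_bound_of_continuousOn
    hc.continuousOn
  refine (hasDerivAt_integral_of_dominated_loc_of_deriv_le (bound := fun _ => C)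
    (F := fun s x => G (s, x)) (F' := fun s x => pt G (s, x))
    (Metric.closedBall_mem_nhds t one_pos) ?_ ?_ ?_ ?_ ?_ ?_).2
  · exact Filter.Eventually.of_forall fun s =>
      (hG.continuous.comp (by fun_prop : Continuous fun x => (s, x))).aestronglyMeasurable
  · exact (hG.continuous.comp (by fun_prop : Continuous fun x => (t, x))).integrableOn_Icc
  · exact (hc.comp (by fun_prop : Continuous fun x => (t, x))).aestronglyMeasurable
  · exact (ae_restrict_iff' measurableSet_Icc).2
      (Filter.Eventually.of_forall fun x hx s hs => hC (s, x) ⟨hs, hx⟩)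
  · exact continuous_const.integrableOn_Icc
  · refine Filter.Eventually.of_forall fun x s _ => ?_
    have := (hG.differentiable (by norm_num) (s, x)).hasFDerivAt.comp_hasDerivAt s
      ((hasDerivAt_id s).prodMk (hasDerivAt_const s x))
    exact this

/-- Chain rule identity relating the derivatives of `f ρ ^ γ`, `f` and `f ρ`. -/
theorem fderiv_mul_rpow_div_add {d : ℕ} {f ρ : Pt d → ℝ} {γ : ℝ} {p : Pt d} (hγ : 1 < γ)
    (hf : DifferentiableAt ℝ f p) (hρ : DifferentiableAt ℝ ρ p) (h0 : 0 < ρ p) (v : Pt d) :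
    fderiv ℝ (fun q => f q * ρ q ^ γ / (γ - 1)) p v + ρ p ^ γ * fderiv ℝ f p v
      = γ / (γ - 1) * ρ p ^ (γ - 1) * fderiv ℝ (fun q => f q * ρ q) p v := by
  have hr := hρ.hasFDerivAt.rpow_const (p := γ) (Or.inl h0.ne')
  have h1 := ((hf.hasFDerivAt.mul hr).mul_const (γ - 1)⁻¹).fderiv
  have h2 := (hf.hasFDerivAt.mul hρ.hasFDerivAt).fderiv
  have hne : γ - 1 ≠ 0 := by linarith
  have hpow : ρ p ^ γ = ρ p ^ (γ - 1) * ρ p := by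
    rw [Real.rpow_sub_one h0.ne']; field_simp
  simp only [div_eq_mul_inv] at *
  simp only [Pi.mul_def] at h1 h2
  rw [h1, h2]
  simp only [smul_apply, add_apply, smul_eq_mul]
  rw [hpow]
  field_simp
  ring

/-- Energy balance of a single phase transported by `u`. -/
theorem phase_energy_balance {d : ℕ} {α ρ : Pt d → ℝ} {u : Pt d → Fin d → ℝ} {γ : ℝ}
    (hγ : 1 < γ) (hα : Differentiable ℝ α) (hρ : Differentiable ℝ ρ)
    (hu : ∀ i, Differentiable ℝ fun q => u q i) (h0 : ∀ p, 0 < ρ p) (p : Pt d)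
    (hmass : pt (fun q => α q * ρ q) p + divg (fun q j => α q * ρ q * u q j) p = 0) :
    pt (fun q => α q * ρ q ^ γ / (γ - 1)) p
        + divg (fun q i => α q * ρ q ^ γ / (γ - 1) * u q i) p
      = -(ρ p ^ γ * (pt α p + divg (fun q i => α q * u q i) p)) := by
  have ht := fderiv_mul_rpow_div_add hγ (hα p) (hρ p) (h0 p) (1, 0)
  have hx (i : Fin d) := fderiv_mul_rpow_div_add (f := fun q => α q * u q i) hγ
    ((hα p).mul (hu i p)) (hρ p) (h0 p) (0, Pi.single i 1)
  have hsum := Finset.sum_congr (rfl : (Finset.univ : Finset (Fin d)) = _) fun i _ => hx i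
  rw [Finset.sum_add_distrib, ← Finset.mul_sum, ← Finset.mul_sum] at hsum
  have e1 (i : Fin d) : (fun q => α q * u q i * ρ q ^ γ / (γ - 1))
      = fun q => α q * ρ q ^ γ / (γ - 1) * u q i := by funext q; ring
  have e2 (i : Fin d) : (fun q => α q * u q i * ρ q) = fun q => α q * ρ q * u q i := by
    funext q; ring
  simp only [e1, e2] at hsum
  simp only [divg, pd, pt] at hmass ⊢
  linear_combination ht + hsum + γ / (γ - 1) * ρ p ^ (γ - 1) * hmass

/-- Local form of the pressure-work identity. -/
theorem pressure_work_eq_pt_add_divg {d : ℕ} {γp γm : ℝ} (hγp : 1 < γp) (hγm : 1 < γm)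
    {αp αm ρp ρm : Pt d → ℝ} {u : Pt d → Fin d → ℝ}
    (hαp : Differentiable ℝ αp) (hαm : Differentiable ℝ αm)
    (hdρp : Differentiable ℝ ρp) (hdρm : Differentiable ℝ ρm)
    (hu : ∀ i, Differentiable ℝ fun q => u q i)
    (hρp : ∀ p, 0 < ρp p) (hρm : ∀ p, 0 < ρm p)
    (hα : ∀ p, αp p + αm p = 1) (p : Pt d)
    (hmassp : pt (fun q => αp q * ρp q) p + divg (fun q j => αp q * ρp q * u q j) p = 0)
    (hmassm : pt (fun q => αm q * ρm q) p + divg (fun q j => αm q * ρm q * u q j) p = 0)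
    (hclosure : ∀ p, ρp p ^ γp = ρm p ^ γm) :
    ∑ i, (αp p * pd i (fun q => ρp q ^ γp) p + αm p * pd i (fun q => ρm q ^ γm) p) * u p i
      = pt (fun q => αp q * ρp q ^ γp / (γp - 1) + αm q * ρm q ^ γm / (γm - 1)) p
        + divg (fun q i => (αp q * ρp q ^ γp / (γp - 1) + αm q * ρm q ^ γm / (γm - 1)
          + ρp q ^ γp) * u q i) p := by
  have bp := phase_energy_balance hγp hαp hdρp hu hρp p hmassp
  have bm := phase_energy_balance hγm hαm hdρm hu hρm p hmassm
  have hrp : Differentiable ℝ fun q => ρp q ^ γp :=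
    hdρp.rpow_const fun q => Or.inl (hρp q).ne'
  have hrm : Differentiable ℝ fun q => ρm q ^ γm :=
    hdρm.rpow_const fun q => Or.inl (hρm q).ne'
  have hEp : Differentiable ℝ fun q => αp q * ρp q ^ γp / (γp - 1)  := by
    simpa only [div_eq_mul_inv] using (hαp.fun_mul hrp).mul_const (γp - 1)⁻¹
  have hEm : Differentiable ℝ fun q => αm q * ρm q ^ γm / (γm - 1)  := by
    simpa only [div_eq_mul_inv] using (hαm.fun_mul hrm).mul_const (γm - 1)⁻¹
  have hPt : pt (fun q => αp q * ρp q ^ γp / (γp - 1) + αm q * ρm q ^ γm / (γm - 1)) p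
      = pt (fun q => αp q * ρp q ^ γp / (γp - 1)) p
        + pt (fun q => αm q * ρm q ^ γm / (γm - 1)) p := by
    simp only [pt]
    rw [fderiv_fun_add (hEp p) (hEm p)]; rfl
  have hα1 : pt αp p + pt αm p = 0 := by
    have h : fderiv ℝ (fun q => αp q + αm q) p = fderiv ℝ αp p + fderiv ℝ αm p :=
      fderiv_fun_add (hαp p) (hαm p)
    simp only [hα, fderiv_fun_const] at h
    have h' := congrArg (fun L : Pt d →L[ℝ] ℝ => L (1, 0)) h
    exact h'.symm
  have hdiv (i : Fin d) : pd i (fun q => αp q * u q i) p + pd i (fun q => αm q * u q i) p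
      = pd i (fun q => u q i) p := by
    have h : fderiv ℝ (fun q => αp q * u q i + αm q * u q i) p
        = fderiv ℝ (fun q => αp q * u q i) p + fderiv ℝ (fun q => αm q * u q i) p :=
      fderiv_fun_add ((hαp p).mul (hu i p)) ((hαm p).mul (hu i p))
    simp only [← add_mul, hα, one_mul] at h
    simp only [pd]
    rw [h]; rfl
  have hflux (i : Fin d) : pd i (fun q => (αp q * ρp q ^ γp / (γp - 1)
        + αm q * ρm q ^ γm / (γm - 1) + ρp q ^ γp) * u q i) p
      = pd i (fun q => αp q * ρp q ^ γp / (γp - 1) * u q i) p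
        + pd i (fun q => αm q * ρm q ^ γm / (γm - 1) * u q i) p
        + (ρp p ^ γp * pd i (fun q => u q i) p + u p i * pd i (fun q => ρp q ^ γp) p) := by
    simp only [pd, add_mul]
    rw [fderiv_fun_add (((hEp p).fun_mul (hu i p)).fun_add ((hEm p).fun_mul (hu i p)))
        ((hrp p).fun_mul (hu i p)),
      fderiv_fun_add ((hEp p).fun_mul (hu i p)) ((hEm p).fun_mul (hu i p)),
      fderiv_fun_mul (hrp p) (hu i p)]
    rfl
  have hsum := Finset.sum_congr (rfl : (Finset.univ : Finset (Fin d)) = _) fun i _ => hdiv i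
  rw [Finset.sum_add_distrib] at hsum
  have hlhs (i : Fin d) : (αp p * pd i (fun q => ρp q ^ γp) p
      + αm p * pd i (fun q => ρm q ^ γm) p) * u p i
      = u p i * pd i (fun q => ρp q ^ γp) p := by
    simp only [← hclosure]
    linear_combination (u p i * pd i (fun q => ρp q ^ γp) p) * hα p
  rw [hPt]
  simp only [divg] at bp bm ⊢
  simp only [hlhs, hflux, Finset.sum_add_distrib, ← Finset.mul_sum]
  rw [← hclosure] at bm
  linear_combination -bp - bm + ρp p ^ γp * (hα1 + hsum)

/-- pressure-work identity under the algebraic closure: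
`∫ (α₊∇(ρ₊^{γ₊}) + α₋∇(ρ₋^{γ₋}))·u = d/dt ∫ [α₊ρ₊^{γ₊}/(γ₊-1) + α₋ρ₋^{γ₋}/(γ₋-1)]`. -/
theorem pressure_work_identity_algebraic_closure
    {d : ℕ} (hd : 1 ≤ d) (γp γm : ℝ) (hγp : 1 < γp) (hγm : 1 < γm)
    (αp αm ρp ρm : Pt d → ℝ) (u : Pt d → Fin d → ℝ)
    (hreg : ContDiff ℝ (⊤ : ℕ∞) αp ∧ ContDiff ℝ (⊤ : ℕ∞) αm ∧ ContDiff ℝ (⊤ : ℕ∞) ρp ∧ ContDiff ℝ (⊤ : ℕ∞) ρm ∧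
      ContDiff ℝ (⊤ : ℕ∞) u)
    (hper : ZPeriodic αp ∧ ZPeriodic αm ∧ ZPeriodic ρp ∧ ZPeriodic ρm ∧ ZPeriodicVec u)
    (hρp : ∀ p, 0 < ρp p) (hρm : ∀ p, 0 < ρm p)
    (hα : ∀ p, αp p + αm p = 1)
    (hmassp : ∀ p, pt (fun q => αp q * ρp q) p
      + divg (fun q j => αp q * ρp q * u q j) p = 0)
    (hmassm : ∀ p, pt (fun q => αm q * ρm q) p
      + divg (fun q j => αm q * ρm q * u q j) p = 0)
    (hclosure : ∀ p, ρp p ^ γp = ρm p ^ γm) :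
    ∀ t : ℝ,
      (∫ x in cell d,
          ∑ i, (αp (t, x) * pd i (fun q => ρp q ^ γp) (t, x)
            + αm (t, x) * pd i (fun q => ρm q ^ γm) (t, x)) * u (t, x) i)
      = deriv (fun s => ∫ x in cell d,
          (αp (s, x) * ρp (s, x) ^ γp / (γp - 1)
            + αm (s, x) * ρm (s, x) ^ γm / (γm - 1))) t := by
  intro t
  obtain ⟨hαp, hαm, hrp, hrm, hu⟩ := hreg
  obtain ⟨pαp, pαm, pρp, pρm, pu⟩ := hper
  have h1 : (1 : WithTop ℕ∞) ≤ ((⊤ : ℕ∞) : WithTop ℕ∞) := by exact_mod_cast le_top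
  replace hαp := hαp.of_le h1
  replace hαm := hαm.of_le h1
  replace hrp := hrp.of_le h1
  replace hrm := hrm.of_le h1
  have hui (i : Fin d) : ContDiff ℝ 1 fun q => u q i := contDiff_pi.1 (hu.of_le h1) i
  have hPp : ContDiff ℝ 1 fun q => ρp q ^ γp := hrp.rpow_const_of_ne fun p => (hρp p).ne'
  have hPm : ContDiff ℝ 1 fun q => ρm q ^ γm := hrm.rpow_const_of_ne fun p => (hρm p).ne'
  have hE : ContDiff ℝ 1 fun q =>
      αp q * ρp q ^ γp / (γp - 1) + αm q * ρm q ^ γm / (γm - 1) :=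
    ((hαp.mul hPp).div_const _).add ((hαm.mul hPm).div_const _)
  have hF (i : Fin d) : ContDiff ℝ 1 fun q => (αp q * ρp q ^ γp / (γp - 1)
      + αm q * ρm q ^ γm / (γm - 1) + ρp q ^ γp) * u q i :=
    (hE.add hPp).mul (hui i)
  have hFper : ZPeriodicVec fun q i => (αp q * ρp q ^ γp / (γp - 1)
      + αm q * ρm q ^ γm / (γm - 1) + ρp q ^ γp) * u q i := by
    intro i k s x
    have hui := pu i k s x
    simp only at hui
    simp only [pαp k s x, pαm k s x, pρp k s x, pρm k s x, hui]
  rw [(hasDerivAt_integral_cell hE t).deriv]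
  have hslice : Continuous fun x : Fin d → ℝ => (t, x) := by fun_prop
  have hdivc : Continuous (divg fun q i => (αp q * ρp q ^ γp / (γp - 1)
      + αm q * ρm q ^ γm / (γm - 1) + ρp q ^ γp) * u q i) :=
    continuous_finsetSum _ fun i _ => continuous_pd (hF i) i
  have hd1 {f : Pt d → ℝ} (hf : ContDiff ℝ 1 f) : Differentiable ℝ f :=
    hf.differentiable one_ne_zero
  simp only [fun x => pressure_work_eq_pt_add_divg hγp hγm (hd1 hαp) (hd1 hαm) (hd1 hrp)
    (hd1 hrm) (fun i => hd1 (hui i)) hρp hρm hα (t, x) (hmassp _) (hmassm _) hclosure]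
  refine (integral_add ((continuous_pt hE).comp hslice).integrableOn_Icc
    (hdivc.comp hslice).integrableOn_Icc).trans ?_
  exact add_eq_left.2 (integral_cell_divg_eq_zero hF hFper t)
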